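/- Let w be a word over {a,b} and x a letter such that wx is a trapezoidal word. Then K_{wx} = K_w + 1 and R_{wx} = R_w, unless either w is closed and wx is open, or w is open and wx is closed; in these two exceptional cases, K_{wx} = R_w + 1 and R_{wx} = K_w. -/

import Mathlib

/-- The two-letter alphabet {a, b}. -/
inductive AB : Type
  | a : AB
  | b : AB
deriving DecidableEq, Repr

/-- A (finite) word over {a, b}. -/
abbrev Word := List AB

open AB

/-- `u` occurs in `w` at position `i`. -/
def OccursAt (u w : Word) (i : ℕ) : Prop :=
  i + u.length ≤ w.length ∧ (w.drop i).take u.length = u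

/-- `u` occurs exactly once in `w` (is unrepeated in `w`). -/
def OccursOnce (u w : Word) : Prop := ∃! i, OccursAt u w i

/-- `u` is a right special factor of `w`: both `ua` and `ub` are factors of `w`. -/
def IsRightSpecial (u w : Word) : Prop := (u ++ [a]) <:+: w ∧ (u ++ [b]) <:+: w

/-- `u` is a left special factor of `w`: both `au` and `bu` are factors of `w`. -/
def IsLeftSpecial (u w : Word) : Prop := ([a] ++ u) <:+: w ∧ ([b] ++ u) <:+: w

/-- `K w`: the length of the shortest unrepeated suffix of `w`. -/
noncomputable def Kp (w : Word) : ℕ := sInf {n | ∃ s : Word, s <:+ w ∧ s.length = n ∧ OccursOnce s w}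

/-- `H w`: the length of the shortest unrepeated prefix of `w`. -/
noncomputable def Hp (w : Word) : ℕ := sInf {n | ∃ p : Word, p <+: w ∧ p.length = n ∧ OccursOnce p w}

/-- `R w`: the smallest `n ≥ 0` such that `w` has no right special factor of length `n`. -/
noncomputable def Rp (w : Word) : ℕ := sInf {n | ∀ u : Word, u.length = n → ¬ IsRightSpecial u w}

/-- `L w`: the smallest `n ≥ 0` such that `w` has no left special factor of length `n`. -/
noncomputable def Lp (w : Word) : ℕ := sInf {n | ∀ u : Word, u.length = n → ¬ IsLeftSpecial u w}

/-- A word `w` is trapezoidal if `|w| = K w + R w`. -/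
def IsTrapezoidal (w : Word) : Prop := w.length = Kp w + Rp w

/-- A finite word over `{a,b}` is Sturmian iff it is balanced: there is no word `u`
with both `aua` and `bub` factors of `w`. -/
def IsSturmian (w : Word) : Prop :=
  ¬ ∃ u : Word, ([a] ++ u ++ [a]) <:+: w ∧ ([b] ++ u ++ [b]) <:+: w

/-- A nonempty word is closed if it has a border (a proper prefix which is also a suffix)
whose only occurrences in `w` are as a prefix and as a suffix. -/
def IsClosedWord (w : Word) : Prop :=
  w ≠ [] ∧ ∃ v : Word, v <+: w ∧ v.length < w.length ∧ v <:+ w ∧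
    ∀ i : ℕ, OccursAt v w i → i = 0 ∨ i + v.length = w.length

/-- A nonempty word is open if it is not closed. -/
def IsOpenWord (w : Word) : Prop := w ≠ [] ∧ ¬ IsClosedWord w

/-- Central words: `a^n`, `b^n`, or `u a b v = v b a u`. -/
def IsCentral (w : Word) : Prop :=
  (∃ n : ℕ, w = List.replicate n a) ∨ (∃ n : ℕ, w = List.replicate n b) ∨
  (∃ u v : Word, w = u ++ [a, b] ++ v ∧ w = v ++ [b, a] ++ u)

/-- The minimal period of `w`: `|w|` minus the length of the longest border of `w`. -/
noncomputable def minPeriod (w : Word) : ℕ :=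
  w.length - sSup {n | ∃ v : Word, v.length = n ∧ v <+: w ∧ v ≠ w ∧ v <:+ w}

theorem occursAt_iff {u w : Word} {i : ℕ} :
    OccursAt u w i ↔ ∃ l r : Word, l.length = i ∧ w = l ++ u ++ r := by
  constructor
  · rintro ⟨h1, h2⟩
    refine ⟨w.take i, (w.drop i).drop u.length, by simp; omega, ?_⟩
    have h3 := List.take_append_drop u.length (w.drop i)
    rw [h2] at h3
    rw [List.append_assoc, h3, List.take_append_drop]
  · rintro ⟨l, r, rfl, rfl⟩
    refine ⟨by simp, by simp [List.append_assoc]⟩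

/-- A suffix is repeated exactly when it is followed by a letter somewhere. -/
theorem occursOnce_suffix_iff {s w : Word} (hs : s <:+ w) :
    OccursOnce s w ↔ ¬ ∃ c, s ++ [c] <:+: w := by
  obtain ⟨l, rfl⟩ := hs
  have h0 : OccursAt s (l ++ s) l.length := occursAt_iff.2 ⟨l, [], rfl, by simp⟩
  constructor
  · rintro h ⟨c, m, r, hr⟩
    have h1 : OccursAt s (l ++ s) m.length :=
      occursAt_iff.2 ⟨m, c :: r, rfl, by simp [← hr]⟩
    have h2 := h.unique h0 h1
    have h3 := congrArg List.length hr
    simp at h3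
    omega
  · intro h
    refine ⟨_, h0, ?_⟩
    intro i hi
    obtain ⟨m, r, rfl, hr⟩ := occursAt_iff.1 hi
    cases r with
    | nil => simpa using (congrArg List.length hr).symm
    | cons c r => exact absurd ⟨c, m, r, by simp [hr]⟩ h

theorem exists_suffix_length {w : Word} {n : ℕ} (h : n ≤ w.length) :
    ∃ s : Word, s <:+ w ∧ s.length = n :=
  ⟨w.drop (w.length - n), List.drop_suffix _ _, by simp; omega⟩

theorem Kp_nonempty (w : Word) :
    {n | ∃ s : Word, s <:+ w ∧ s.length = n ∧ OccursOnce s w}.Nonempty := by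
  refine ⟨w.length, w, List.suffix_rfl, rfl, (occursOnce_suffix_iff List.suffix_rfl).2 ?_⟩
  rintro ⟨c, h⟩
  simpa using h.length_le

theorem Kp_le_length (w : Word) : Kp w ≤ w.length := by
  obtain ⟨s, hs, hl, -⟩ := Nat.sInf_mem (Kp_nonempty w)
  exact hl.symm.le.trans hs.length_le

theorem length_lt_Kp_iff {s w : Word} (hs : s <:+ w) :
    s.length < Kp w ↔ ∃ c, s ++ [c] <:+: w := by
  constructor
  · intro h
    by_contra hc
    exact Nat.notMem_of_lt_sInf h ⟨s, hs, rfl, (occursOnce_suffix_iff hs).2 hc⟩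
  · rintro ⟨c, h⟩
    by_contra! hk
    obtain ⟨t, ht, hl, ho⟩ := Nat.sInf_mem (Kp_nonempty w)
    refine (occursOnce_suffix_iff ht).1 ho ⟨c, List.IsInfix.trans ?_ h⟩
    have : t <:+ s := List.suffix_of_suffix_length_le ht hs (hl.le.trans hk)
    obtain ⟨m, rfl⟩ := this
    exact ⟨m, [], by simp⟩

theorem isRightSpecial_iff {u w : Word} : IsRightSpecial u w ↔ ∀ c, u ++ [c] <:+: w := by
  constructor
  · rintro ⟨h1, h2⟩ (_ | _) <;> assumption
  · exact fun h => ⟨h a, h b⟩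

theorem isRightSpecial_of_ne {u w : Word} {c d : AB} (h : c ≠ d) (hc : u ++ [c] <:+: w)
    (hd : u ++ [d] <:+: w) : IsRightSpecial u w := by
  cases c <;> cases d <;> first | exact absurd rfl h | exact ⟨hc, hd⟩ | exact ⟨hd, hc⟩

theorem IsRightSpecial.of_suffix {u v w : Word} (h : IsRightSpecial v w) (hu : u <:+ v) :
    IsRightSpecial u w := by
  obtain ⟨m, rfl⟩ := hu
  exact isRightSpecial_iff.2 fun c =>
    List.IsInfix.trans ⟨m, [], by simp⟩ (isRightSpecial_iff.1 h c)

theorem Rp_nonempty (w : Word) :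
    {n | ∀ u : Word, u.length = n → ¬ IsRightSpecial u w}.Nonempty := by
  refine ⟨w.length, fun u hu h => ?_⟩
  have := h.1.length_le
  simp at this
  omega

theorem IsRightSpecial.length_lt {u w : Word} (h : IsRightSpecial u w) : u.length < Rp w := by
  by_contra! hk
  obtain ⟨s, hs, hl⟩ := exists_suffix_length hk
  exact Nat.sInf_mem (Rp_nonempty w) s hl (h.of_suffix hs)

theorem exists_isRightSpecial {w : Word} {n : ℕ} (h : n < Rp w) :
    ∃ u : Word, u.length = n ∧ IsRightSpecial u w := by
  simpa using Nat.notMem_of_lt_sInf h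

theorem concat_infix_concat_iff {u w : Word} {c x : AB} :
    u ++ [c] <:+: w ++ [x] ↔ (c = x ∧ u <:+ w) ∨ u ++ [c] <:+: w := by
  have : u ++ [c] <:+ w ++ [x] ↔ c = x ∧ u <:+ w := by
    constructor
    · rintro ⟨l, h⟩
      rw [← List.append_assoc] at h
      obtain ⟨h1, h2⟩ := List.append_inj' h rfl
      exact ⟨by simpa using h2, l, h1⟩
    · rintro ⟨rfl, l, rfl⟩
      exact ⟨l, by simp⟩
  rw [List.infix_concat_iff, this]

theorem infix_iff_exists_concat_infix_concat {u w : Word} {x : AB} :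
    u <:+: w ↔ ∃ c, u ++ [c] <:+: w ++ [x] := by
  constructor
  · rintro ⟨l, r, rfl⟩
    cases r with
    | nil => exact ⟨x, l, [], by simp⟩
    | cons c r => exact ⟨c, l, r ++ [x], by simp⟩
  · rintro ⟨c, h⟩
    rcases concat_infix_concat_iff.1 h with ⟨-, h⟩ | h
    · exact h.isInfix
    · exact (List.prefix_append _ _).isInfix.trans h

theorem infix_append_singleton {u w : Word} (x : AB) (h : u <:+: w) : u <:+: w ++ [x] :=
  h.trans (List.prefix_append _ _).isInfix

theorem length_succ_lt_Kp_concat_iff {s w : Word} {x : AB} (hs : s <:+ w) :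
    s.length + 1 < Kp (w ++ [x]) ↔ s ++ [x] <:+: w := by
  obtain ⟨l, rfl⟩ := hs
  have h : s ++ [x] <:+ l ++ s ++ [x] := ⟨l, by simp⟩
  rw [infix_iff_exists_concat_infix_concat (x := x), ← length_lt_Kp_iff h]
  simp

theorem Kp_concat_pos (w : Word) (x : AB) : 0 < Kp (w ++ [x]) :=
  (length_lt_Kp_iff (s := []) List.nil_suffix).2 ⟨x, w, [], by simp⟩

theorem Kp_concat_le (w : Word) (x : AB) : Kp (w ++ [x]) ≤ Kp w + 1 := by
  obtain ⟨s, hs, hl⟩ := exists_suffix_length (Kp_le_length w)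
  by_contra! h
  rw [← hl, length_succ_lt_Kp_concat_iff hs] at h
  exact absurd ((length_lt_Kp_iff hs).2 ⟨x, h⟩) (by omega)

theorem IsRightSpecial.concat {u w : Word} (x : AB) (h : IsRightSpecial u w) :
    IsRightSpecial u (w ++ [x]) :=
  ⟨infix_append_singleton x h.1, infix_append_singleton x h.2⟩

/-- A right special factor created by appending `x` is a repeated suffix `u` such that
`u ++ [x]` is new. -/
theorem IsRightSpecial.of_concat {u w : Word} {x : AB} (h : IsRightSpecial u (w ++ [x])) :
    IsRightSpecial u w ∨
      (u <:+ w ∧ u.length < Kp w ∧ Kp (w ++ [x]) ≤ u.length + 1) := by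
  by_cases hw : IsRightSpecial u w
  · exact Or.inl hw
  right
  rw [isRightSpecial_iff] at h
  have hy : ∀ c, c ≠ x → u ++ [c] <:+: w := fun c hc =>
    (concat_infix_concat_iff.1 (h c)).resolve_left fun h => hc h.1
  obtain ⟨c, hc⟩ : ∃ c, c ≠ x := by
    cases x
    · exact ⟨b, by simp⟩
    · exact ⟨a, by simp⟩
  have hx : ¬ u ++ [x] <:+: w := fun h' => hw (isRightSpecial_of_ne hc (hy c hc) h')
  have hs : u <:+ w := ((concat_infix_concat_iff.1 (h x)).resolve_right hx).2
  refine ⟨hs, (length_lt_Kp_iff hs).2 ⟨c, hy c hc⟩, ?_⟩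
  rw [← length_succ_lt_Kp_concat_iff hs] at hx
  omega

theorem Kp_Rp_concat (w : Word) (x : AB) :
    (Kp (w ++ [x]) = Kp w + 1 ∧ Rp (w ++ [x]) = Rp w) ∨
      (Kp (w ++ [x]) ≤ Kp w ∧ Kp (w ++ [x]) ≤ Rp w + 1 ∧
        Rp (w ++ [x]) = max (Rp w) (Kp w)) := by
  rcases (Kp_concat_le w x).eq_or_lt with h | h
  · left
    refine ⟨h, ?_⟩
    have : ∀ u, IsRightSpecial u (w ++ [x]) ↔ IsRightSpecial u w := fun u =>
      ⟨fun hu => hu.of_concat.resolve_right (by omega), fun hu => hu.concat x⟩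
    simp only [Rp, this]
  right
  have hpos := Kp_concat_pos w x
  have hlen := Kp_le_length w
  refine ⟨by omega, ?_, le_antisymm ?_ (max_le ?_ ?_)⟩
  · by_contra! hR
    obtain ⟨s, hs, hl⟩ := exists_suffix_length (w := w) (n := Kp (w ++ [x]) - 1) (by omega)
    obtain _ | ⟨z, t⟩ := s
    · simp at hl
      omega
    simp only [List.length_cons] at hl
    have ht : t <:+ w := (List.suffix_cons z t).trans hs
    have h1 : t ++ [x] <:+: w := (length_succ_lt_Kp_concat_iff ht).1 (by omega)
    obtain ⟨c, hc⟩ := (length_lt_Kp_iff hs).1 (by simp; omega)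
    have hcx : c ≠ x := by
      rintro rfl
      have := (length_succ_lt_Kp_concat_iff hs).2 hc
      simp at this
      omega
    have := (isRightSpecial_of_ne hcx ((List.suffix_cons z _).isInfix.trans hc) h1).length_lt
    omega
  · by_contra! hR
    obtain ⟨u, hl, hu⟩ := exists_isRightSpecial hR
    rcases hu.of_concat with hu | ⟨-, hu, -⟩
    · have := hu.length_lt
      omega
    · omega
  · by_contra! hR
    obtain ⟨u, hl, hu⟩ := exists_isRightSpecial hR
    have := (hu.concat x).length_lt
    omega
  · obtain ⟨s, hs, hl⟩ := exists_suffix_length (w := w) (n := Kp w - 1) (by omega)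
    obtain ⟨c, hc⟩ := (length_lt_Kp_iff hs).1 (by omega)
    have hcx : c ≠ x := by
      rintro rfl
      have := (length_succ_lt_Kp_concat_iff hs).2 hc
      omega
    have := (isRightSpecial_of_ne hcx (infix_append_singleton x hc)
      (concat_infix_concat_iff.2 (Or.inl ⟨rfl, hs⟩))).length_lt
    omega

theorem Rp_nil : Rp [] = 0 := by
  by_contra h
  obtain ⟨u, -, hu⟩ := exists_isRightSpecial (Nat.pos_of_ne_zero h)
  simpa using hu.1

theorem Kp_add_Rp_le (w : Word) : Kp w + Rp w ≤ w.length := by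
  induction w using List.reverseRecOn with
  | nil =>
    have := Kp_le_length []
    simp_all [Rp_nil]
  | append_singleton w x ih =>
    have := Kp_Rp_concat w x
    simp only [List.length_append, List.length_singleton]
    omega

theorem IsTrapezoidal.concat {w : Word} {x : AB} (h : IsTrapezoidal (w ++ [x])) :
    IsTrapezoidal w ∧ ((Kp (w ++ [x]) = Kp w + 1 ∧ Rp (w ++ [x]) = Rp w) ∨
      (Kp (w ++ [x]) = Rp w + 1 ∧ Rp (w ++ [x]) = Kp w ∧ Rp w ≤ Kp w)) := by
  have h1 := Kp_Rp_concat w x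
  have h2 := Kp_add_Rp_le w
  simp only [IsTrapezoidal, List.length_append, List.length_singleton] at *
  omega

theorem IsTrapezoidal.rightSpecial_unique {w u v : Word} (h : IsTrapezoidal w)
    (hu : IsRightSpecial u w) (hv : IsRightSpecial v w) (huv : u.length = v.length) : u = v := by
  induction w using List.reverseRecOn with
  | nil => simpa using hu.1
  | append_singleton w x ih =>
    obtain ⟨hw, hKR⟩ := h.concat
    rcases hu.of_concat with hu | ⟨hu, hu1, hu2⟩ <;> rcases hv.of_concat with hv | ⟨hv, hv1, hv2⟩
    · exact ih hw hu hv
    · have := hu.length_lt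
      omega
    · have := hv.length_lt
      omega
    · exact (List.suffix_of_suffix_length_le hu hv huv.le).eq_of_length huv

/-- `p` is the longest repeated prefix of `w`, and it is followed by `y` as a prefix. -/
structure IsLongestRepeatedPrefix (p : Word) (y : AB) (w : Word) : Prop where
  isPrefix : p ++ [y] <+: w
  repeated : ∃ z, z :: p <:+: w
  unrepeated : ∀ z, ¬ z :: (p ++ [y]) <:+: w

theorem isClosedWord_of_border {v w : Word} (hlen : v.length < w.length) (hp : v <+: w)
    (hs : v <:+ w) (hi : ∀ z c, ¬ z :: (v ++ [c]) <:+: w) : IsClosedWord w := by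
  refine ⟨by rintro rfl; simp at hlen, v, hp, hlen, hs, fun i hocc => ?_⟩
  obtain ⟨l, r, rfl, hw⟩ := occursAt_iff.1 hocc
  rcases List.eq_nil_or_concat l with rfl | ⟨l, z, rfl⟩
  · simp
  cases r with
  | nil =>
    right
    simp [hw]
    omega
  | cons c r => exact absurd ⟨l, r, by simp [hw]⟩ (hi z c)

theorem IsClosedWord.exists_border {w : Word} (h : IsClosedWord w) :
    ∃ v : Word, v.length < w.length ∧ v <+: w ∧ v <:+ w ∧ ∀ z c, ¬ z :: (v ++ [c]) <:+: w := by
  obtain ⟨-, v, hp, hlen, hs, hi⟩ := h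
  refine ⟨v, hlen, hp, hs, ?_⟩
  rintro z c ⟨l, r, hw⟩
  have h1 := hi (l.length + 1)
    (occursAt_iff.2 ⟨l ++ [z], c :: r, by simp, by simp [← hw]⟩)
  have h2 := congrArg List.length hw
  simp at h2
  omega

theorem exists_concat_prefix {v w : Word} (h : v <+: w) (hlen : v.length < w.length) :
    ∃ c, v ++ [c] <+: w := by
  obtain ⟨r, rfl⟩ := h
  cases r with
  | nil => simp at hlen
  | cons c r => exact ⟨c, r, by simp⟩

theorem exists_cons_suffix {v w : Word} (h : v <:+ w) (hlen : v.length < w.length) :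
    ∃ z, z :: v <:+ w := by
  obtain ⟨l, rfl⟩ := h
  rcases List.eq_nil_or_concat l with rfl | ⟨l, z, rfl⟩
  · simp at hlen
  · exact ⟨z, l, by simp⟩

namespace IsLongestRepeatedPrefix

variable {p w : Word} {x y : AB}

theorem length_lt (h : IsLongestRepeatedPrefix p y w) : p.length < w.length := by
  simpa using h.isPrefix.length_le

theorem isClosedWord_iff (h : IsLongestRepeatedPrefix p y w) :
    IsClosedWord w ↔ p <:+ w ∧ ∀ z c, ¬ z :: (p ++ [c]) <:+: w := by
  have hp : p <+: w := (List.prefix_append _ _).trans h.isPrefix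
  refine ⟨fun hw => ?_, fun hw => isClosedWord_of_border h.length_lt hp hw.1 hw.2⟩
  obtain ⟨v, hlen, hvp, hvs, hvi⟩ := hw.exists_border
  suffices v = p by
    subst this
    exact ⟨hvs, hvi⟩
  rcases lt_trichotomy v.length p.length with hl | hl | hl
  · obtain ⟨c, hc⟩ := exists_concat_prefix (List.prefix_of_prefix_length_le hvp hp hl.le) hl
    obtain ⟨z, hz⟩ := h.repeated
    exact absurd (((List.cons_prefix_cons.2 ⟨rfl, hc⟩).isInfix).trans hz) (hvi z c)
  · exact (List.prefix_of_prefix_length_le hvp hp hl.le).eq_of_length hl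
  · obtain ⟨z, hz⟩ := exists_cons_suffix hvs hlen
    have h1 : p ++ [y] <+: v :=
      List.prefix_of_prefix_length_le h.isPrefix hvp (by simpa using hl)
    exact absurd (((List.cons_prefix_cons.2 ⟨rfl, h1⟩).isInfix).trans hz.isInfix)
      (h.unrepeated z)

theorem Kp_eq (h : IsLongestRepeatedPrefix p y w) (hw : IsClosedWord w) :
    Kp w = p.length + 1 := by
  obtain ⟨hs, hi⟩ := h.isClosedWord_iff.1 hw
  have h1 := (length_lt_Kp_iff hs).2 ⟨y, h.isPrefix.isInfix⟩
  obtain ⟨z, hz⟩ := exists_cons_suffix hs h.length_lt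
  have h2 := mt (length_lt_Kp_iff hz).1 (by rintro ⟨c, hc⟩; exact hi z c hc)
  simp at h2
  omega

theorem isRightSpecial (h : IsLongestRepeatedPrefix p y w) (hw : ¬ IsClosedWord w) :
    IsRightSpecial p w := by
  have : ∃ z c, z :: (p ++ [c]) <:+: w := by
    by_contra! hi
    refine hw (h.isClosedWord_iff.2 ⟨?_, hi⟩)
    obtain ⟨z, l, r, hr⟩ := h.repeated
    cases r with
    | nil => exact ⟨l ++ [z], by simpa using hr⟩
    | cons c r => exact absurd ⟨l, r, by simp [← hr]⟩ (hi z c)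
  obtain ⟨z, c, hc⟩ := this
  refine isRightSpecial_of_ne ?_ ((List.suffix_cons z _).isInfix.trans hc) h.isPrefix.isInfix
  rintro rfl
  exact h.unrepeated z hc

theorem concat_of_suffix (h : IsLongestRepeatedPrefix p y w) (hs : p ++ [y] <:+ w ++ [x]) :
    IsClosedWord (w ++ [x]) ∧ ∃ c, IsLongestRepeatedPrefix (p ++ [y]) c (w ++ [x]) := by
  have hp : p ++ [y] <+: w ++ [x] := h.isPrefix.trans (List.prefix_append _ _)
  have hlen : (p ++ [y]).length < (w ++ [x]).length := by
    have := h.length_lt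
    simpa
  have hi : ∀ z c, ¬ z :: (p ++ [y] ++ [c]) <:+: w ++ [x] := fun z c hc =>
    h.unrepeated z (infix_iff_exists_concat_infix_concat.2 ⟨c, hc⟩)
  obtain ⟨c, hc⟩ := exists_concat_prefix hp hlen
  obtain ⟨z, hz⟩ := exists_cons_suffix hs hlen
  exact ⟨isClosedWord_of_border hlen hp hs hi, c, hc, ⟨z, hz.isInfix⟩, fun z => hi z c⟩

theorem concat_of_not_suffix (h : IsLongestRepeatedPrefix p y w)
    (hs : ¬ p ++ [y] <:+ w ++ [x]) :
    ¬ IsClosedWord (w ++ [x]) ∧ IsLongestRepeatedPrefix p y (w ++ [x]) := by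
  obtain ⟨z, hz⟩ := h.repeated
  have h' : IsLongestRepeatedPrefix p y (w ++ [x]) := by
    refine ⟨h.isPrefix.trans (List.prefix_append _ _), ⟨z, infix_append_singleton x hz⟩, ?_⟩
    intro z hz
    rcases List.infix_concat_iff.1 hz with hz | hz
    · exact hs ((List.suffix_cons z _).trans hz)
    · exact h.unrepeated z hz
  refine ⟨fun hc => ?_, h'⟩
  obtain ⟨c, hc'⟩ := infix_iff_exists_concat_infix_concat.1 hz
  exact (h'.isClosedWord_iff.1 hc).2 z c hc'

theorem Rp_concat_eq (h : IsLongestRepeatedPrefix p y w) (ht : IsTrapezoidal (w ++ [x]))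
    (hR : ¬ IsClosedWord w → Rp w = p.length + 1) (hs : ¬ p ++ [y] <:+ w ++ [x]) :
    Rp (w ++ [x]) = p.length + 1 := by
  obtain ⟨hw, hKR⟩ := ht.concat
  by_cases hc : IsClosedWord w
  · have hK := h.Kp_eq hc
    rcases hKR with ⟨hK', -⟩ | hKR
    · obtain ⟨hps, hpi⟩ := h.isClosedWord_iff.1 hc
      obtain ⟨l, r, hlr⟩ := (length_succ_lt_Kp_concat_iff (x := x) hps).1 (by omega)
      rcases List.eq_nil_or_concat l with rfl | ⟨l, z, rfl⟩
      · have h1 : p ++ [x] <+: w := ⟨r, by simpa using hlr⟩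
        have h2 := (List.prefix_of_prefix_length_le h1 h.isPrefix (by simp)).eq_of_length
          (by simp)
        obtain ⟨m, rfl⟩ := hps
        exact absurd ⟨m, by simp [← h2]⟩ hs
      · exact absurd ⟨l, r, by simp [← hlr]⟩ (hpi z x)
    · omega
  · have hR := hR hc
    rcases hKR with hKR | ⟨hK', hR', hle⟩
    · omega
    rcases hle.eq_or_lt with heq | hlt
    · omega
    exfalso
    have hlen := Kp_le_length w
    obtain ⟨s, hsw, hl⟩ := exists_suffix_length (hlt.le.trans hlen)
    obtain _ | ⟨z, t⟩ := s
    · simp at hl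
      omega
    simp only [List.length_cons] at hl
    have htw : t <:+ w := (List.suffix_cons z t).trans hsw
    have h1 : t ++ [x] <:+: w := (length_succ_lt_Kp_concat_iff htw).1 (by omega)
    obtain ⟨c, hzc⟩ := (length_lt_Kp_iff hsw).1 (by simp; omega)
    have hcx : c ≠ x := by
      rintro rfl
      have := (length_succ_lt_Kp_concat_iff hsw).2 hzc
      simp at this
      omega
    obtain rfl : t = p := hw.rightSpecial_unique
      (isRightSpecial_of_ne hcx ((List.suffix_cons z _).isInfix.trans hzc) h1)
      (h.isRightSpecial hc) (by omega)
    have hcy : c ≠ y := by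
      rintro rfl
      exact h.unrepeated z hzc
    have hxy : x = y := by
      clear * - hcx hcy
      cases c <;> cases x <;> cases y <;> simp_all
    obtain ⟨m, rfl⟩ := htw
    exact hs ⟨m, by simp [hxy]⟩

end IsLongestRepeatedPrefix

theorem isLongestRepeatedPrefix_singleton (x : AB) : IsLongestRepeatedPrefix [] x [x] :=
  ⟨by simp, ⟨x, by simp⟩, fun z h => by simpa using h.length_le⟩

theorem isClosedWord_singleton (x : AB) : IsClosedWord [x] :=
  (isLongestRepeatedPrefix_singleton x).isClosedWord_iff.2
    ⟨List.nil_suffix, fun z c h => by simpa using h.length_le⟩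

/-- For open trapezoidal words, `R w` is the length of the shortest unrepeated prefix. -/
theorem IsTrapezoidal.exists_isLongestRepeatedPrefix {w : Word} (h : IsTrapezoidal w)
    (hne : w ≠ []) :
    ∃ p y, IsLongestRepeatedPrefix p y w ∧ (¬ IsClosedWord w → Rp w = p.length + 1) := by
  induction w using List.reverseRecOn with
  | nil => exact absurd rfl hne
  | append_singleton w x ih =>
    rcases eq_or_ne w [] with rfl | hw
    · exact ⟨[], x, isLongestRepeatedPrefix_singleton x,
        fun hc => absurd (isClosedWord_singleton x) hc⟩
    obtain ⟨p, y, hp, hR⟩ := ih h.concat.1 hw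
    by_cases hs : p ++ [y] <:+ w ++ [x]
    · obtain ⟨hc, c, hp'⟩ := hp.concat_of_suffix hs
      exact ⟨_, c, hp', fun h => absurd hc h⟩
    · exact ⟨p, y, (hp.concat_of_not_suffix hs).2, fun _ => hp.Rp_concat_eq h hR hs⟩

/-- behavior of `K` and `R` under right extension of trapezoidal words. -/
theorem K_R_right_extension (w : Word) (x : AB) (htrap : IsTrapezoidal (w ++ [x])) :
    (¬ ((IsClosedWord w ∧ IsOpenWord (w ++ [x])) ∨ (IsOpenWord w ∧ IsClosedWord (w ++ [x]))) →
      Kp (w ++ [x]) = Kp w + 1 ∧ Rp (w ++ [x]) = Rp w) ∧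
    ((IsClosedWord w ∧ IsOpenWord (w ++ [x])) ∨ (IsOpenWord w ∧ IsClosedWord (w ++ [x])) →
      Kp (w ++ [x]) = Rp w + 1 ∧ Rp (w ++ [x]) = Kp w) := by
  obtain ⟨hw, hKR⟩ := htrap.concat
  rcases eq_or_ne w [] with rfl | hne
  · have hK := Kp_le_length []
    have hR := Rp_nil
    have hpos := Kp_concat_pos [] x
    refine ⟨fun _ => ?_, ?_⟩
    · simp only [List.length_nil] at hK
      omega
    · rintro (⟨h, -⟩ | ⟨h, -⟩) <;> exact absurd rfl h.1
  obtain ⟨p, y, hp, hR⟩ := hw.exists_isLongestRepeatedPrefix hne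
  by_cases hs : p ++ [y] <:+ w ++ [x]
  · obtain ⟨hc', c, hp'⟩ := hp.concat_of_suffix hs
    have hK' := hp'.Kp_eq hc'
    simp only [List.length_append, List.length_singleton] at hK'
    by_cases hc : IsClosedWord w
    · have hK := hp.Kp_eq hc
      simp [IsOpenWord, hc, hc', hne]
      omega
    · have hR := hR hc
      simp [IsOpenWord, hc, hc', hne]
      omega
  · have hc' := (hp.concat_of_not_suffix hs).1
    have hR' := hp.Rp_concat_eq htrap hR hs
    by_cases hc : IsClosedWord w
    · have hK := hp.Kp_eq hc
      simp [IsOpenWord, hc, hc', hne]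
      omega
    · have hR := hR hc
      simp [IsOpenWord, hc, hc', hne]
      omega
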